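/- Fix ε>0 and a binary-secret prior P(S,Y). For any ε-IP Blackwell optimal information structure, there exists an ε-IP Blackwell optimal information structure P(S,Y,T) with the same marginal on (S,Y), with 𝒯 = {t₁,t₂,t₃,t₄}, achieving the same value of Σ_{t:P(T=t)>0} P(T=t)·u(P(Y=1|T=t)) for every convex u:[0,1]→ℝ, and whose conditional probabilities l_i^{(j)} := P(T=t_i|S=s_j) satisfy: l₁^{(1)} = q_{s₁}; l₄^{(0)} = 1−q_{s₀}; l₂^{(0)} = e^ε·l₂^{(1)}; l₃^{(1)} = e^ε·l₃^{(0)}; e^{−ε}·l₁^{(1)} ≤ l₁^{(0)} ≤ e^ε·l₁^{(1)}; e^{−ε}·l₄^{(0)} ≤ l₄^{(1)} ≤ e^ε·l₄^{(0)}; Σ_{i=1}^{4} l_i^{(j)} = 1 for j∈{0,1}; and l_i^{(j)} ≥ 0 for all i,j. -/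

import Mathlib

open Real
open scoped Classical

noncomputable section

namespace IPPaper

variable {S T : Type} [Fintype S] [Fintype T]

/-- Marginal probability of the secret `S`. -/
def pS (P : S → Bool → T → ℝ) (s : S) : ℝ := ∑ y, ∑ t, P s y t

/-- Marginal probability of the signal `T`. -/
def pT (P : S → Bool → T → ℝ) (t : T) : ℝ := ∑ s, ∑ y, P s y t

/-- Joint marginal on `(S,T)`. -/
def pST (P : S → Bool → T → ℝ) (s : S) (t : T) : ℝ := ∑ y, P s y t

/-- Joint marginal on `(Y,T)`. -/
def pYT (P : S → Bool → T → ℝ) (y : Bool) (t : T) : ℝ := ∑ s, P s y t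

/-- Joint marginal on `(S,Y)`. -/
def pSY (P : S → Bool → T → ℝ) (s : S) (y : Bool) : ℝ := ∑ t, P s y t

/-- An information structure: nonnegative, sums to one, every secret has positive
probability. -/
def InfoStructure (P : S → Bool → T → ℝ) : Prop :=
  (∀ s y t, 0 ≤ P s y t) ∧ (∑ s, ∑ y, ∑ t, P s y t) = 1 ∧ ∀ s, 0 < pS P s

/-- Conditional probability `P(T = t | S = s)`. -/
def condTS (P : S → Bool → T → ℝ) (t : T) (s : S) : ℝ := pST P s t / pS P s

/-- Conditional probability `P(S = s | T = t)`. -/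
def condST (P : S → Bool → T → ℝ) (s : S) (t : T) : ℝ := pST P s t / pT P t

/-- Posterior `P(Y = 1 | T = t)`. -/
def postYT (P : S → Bool → T → ℝ) (t : T) : ℝ := pYT P true t / pT P t

/-- Posterior `P(Y = 1 | S = s, T = t)`. -/
def postYST (P : S → Bool → T → ℝ) (s : S) (t : T) : ℝ := P s true t / pST P s t

/-- Prior conditional `P(Y = 1 | S = s)`. -/
def qS (P : S → Bool → T → ℝ) (s : S) : ℝ := pSY P s true / pS P s

/-- `ε`-inferential privacy. -/
def IsIP (ε : ℝ) (P : S → Bool → T → ℝ) : Prop :=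
  ∀ s₁ s₂ t, condTS P t s₁ ≤ Real.exp ε * condTS P t s₂

/-- Blackwell dominance via a row-stochastic garbling kernel. -/
def BlackwellDom {T₁ T₂ : Type} [Fintype T₁] [Fintype T₂]
    (Q₁ : Bool → T₁ → ℝ) (Q₂ : Bool → T₂ → ℝ) : Prop :=
  ∃ G : T₁ → T₂ → ℝ, (∀ a b, 0 ≤ G a b) ∧ (∀ a, ∑ b, G a b = 1) ∧
    ∀ y b, Q₂ y b = ∑ a, Q₁ y a * G a b

/-- `ε`-IP Blackwell optimality: no ε-IP information structure with the same
marginal on `(S,Y)` (over any finite signal set) strictly Blackwell dominates it. -/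
def BlackwellOptimal (ε : ℝ) (P : S → Bool → T → ℝ) : Prop :=
  InfoStructure P ∧ IsIP ε P ∧
  ¬ ∃ (n : ℕ) (P' : S → Bool → Fin n → ℝ),
      InfoStructure P' ∧ IsIP ε P' ∧ (∀ s y, pSY P' s y = pSY P s y) ∧
      BlackwellDom (pYT P') (pYT P) ∧ ¬ BlackwellDom (pYT P) (pYT P')

/-- Membership in `T̃`: signals with positive probability and nondegenerate posterior. -/
def inTildeT (P : S → Bool → T → ℝ) (t : T) : Prop :=
  0 < pT P t ∧ postYT P t ≠ 0 ∧ postYT P t ≠ 1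

/-- `L_t = min_s P(T=t|S=s)`. -/
def Lval [Nonempty S] (P : S → Bool → T → ℝ) (t : T) : ℝ :=
  Finset.univ.inf' Finset.univ_nonempty (fun s => condTS P t s)

/-- `H_t = max_s P(T=t|S=s)`. -/
def Hval [Nonempty S] (P : S → Bool → T → ℝ) (t : T) : ℝ :=
  Finset.univ.sup' Finset.univ_nonempty (fun s => condTS P t s)

/-- Expected utility `Σ_{t : P(T=t)>0} P(T=t)·u(P(Y=1|T=t))`. -/
def EU (P : S → Bool → T → ℝ) (u : ℝ → ℝ) : ℝ :=
  ∑ t ∈ Finset.univ.filter (fun t => 0 < pT P t), pT P t * u (postYT P t)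

end IPPaper

namespace IPPaper

theorem BlackwellDom.trans {T₁ T₂ T₃ : Type} [Fintype T₁] [Fintype T₂] [Fintype T₃]
    {Q₁ : Bool → T₁ → ℝ} {Q₂ : Bool → T₂ → ℝ} {Q₃ : Bool → T₃ → ℝ}
    (h₁₂ : BlackwellDom Q₁ Q₂) (h₂₃ : BlackwellDom Q₂ Q₃) : BlackwellDom Q₁ Q₃ := by
  obtain ⟨G, hG0, hG1, hG⟩ := h₁₂
  obtain ⟨H, hH0, hH1, hH⟩ := h₂₃
  refine ⟨fun a c => ∑ b, G a b * H b c,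
    fun a c => Finset.sum_nonneg fun b _ => mul_nonneg (hG0 a b) (hH0 b c), fun a => ?_,
    fun y c => ?_⟩
  · rw [Finset.sum_comm]
    simp_rw [← Finset.mul_sum, hH1, mul_one, hG1]
  · rw [hH]
    simp_rw [hG, Finset.sum_mul, Finset.mul_sum]
    rw [Finset.sum_comm]
    simp_rw [mul_assoc]

/-- Splitting each `Q₁`-signal `i`, of direction `w i`, into pieces of sizes `g i b` and
recombining the pieces yields a garbling. -/
theorem blackwellDom_of_split {T₁ T₂ : Type} [Fintype T₁] [Fintype T₂] [Nonempty T₂]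
    {Q₁ : Bool → T₁ → ℝ} {Q₂ : Bool → T₂ → ℝ} (w : T₁ → Bool → ℝ) (g : T₁ → T₂ → ℝ)
    (hg : ∀ i b, 0 ≤ g i b) (h₁ : ∀ y i, Q₁ y i = w i y * ∑ b, g i b)
    (h₂ : ∀ y b, Q₂ y b = ∑ i, w i y * g i b) : BlackwellDom Q₁ Q₂ := by
  refine ⟨fun i b => if ∑ b, g i b = 0 then (Fintype.card T₂ : ℝ)⁻¹ else g i b / ∑ b, g i b,
    fun i b => ?_, fun i => ?_, fun y b => ?_⟩
  · dsimp only
    split_ifs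
    · positivity
    · exact div_nonneg (hg i b) (Finset.sum_nonneg fun b _ => hg i b)
  · dsimp only
    split_ifs with h
    · simp
    · rw [← Finset.sum_div, div_self h]
  · rw [h₂]
    refine Finset.sum_congr rfl fun i _ => ?_
    rw [h₁]
    dsimp only
    split_ifs with h
    · have : g i b = 0 :=
        (Finset.sum_eq_zero_iff_of_nonneg fun b _ => hg i b).1 h b (Finset.mem_univ b)
      rw [h, this]
      simp
    · field_simp

theorem pT_eq_add {S T : Type} [Fintype S] (P : S → Bool → T → ℝ) (t : T) :
    pT P t = pYT P true t + pYT P false t := by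
  simp [pT, pYT, Finset.sum_add_distrib]

theorem pYT_nonneg {S T : Type} [Fintype S] {P : S → Bool → T → ℝ}
    (h : ∀ s y t, 0 ≤ P s y t) (y : Bool) (t : T) : 0 ≤ pYT P y t :=
  Finset.sum_nonneg fun s _ => h s y t

theorem EU_le_of_blackwellDom {S₁ S₂ T₁ T₂ : Type} [Fintype S₁] [Fintype S₂] [Fintype T₁]
    [Fintype T₂] {P₁ : S₁ → Bool → T₁ → ℝ} {P₂ : S₂ → Bool → T₂ → ℝ}
    (h₁ : ∀ s y t, 0 ≤ P₁ s y t)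
    (hdom : BlackwellDom (pYT P₁) (pYT P₂)) {u : ℝ → ℝ}
    (hu : ConvexOn ℝ (Set.Icc 0 1) u) : EU P₂ u ≤ EU P₁ u := by
  obtain ⟨G, hG0, hG1, hG⟩ := hdom
  have hY := pYT_nonneg h₁
  have hpT0 : ∀ a, 0 ≤ pT P₁ a := fun a => by
    rw [pT_eq_add]; exact add_nonneg (hY _ a) (hY _ a)
  have hpT : ∀ b, pT P₂ b = ∑ a, pT P₁ a * G a b := fun b => by
    simp_rw [pT_eq_add, hG, add_mul, Finset.sum_add_distrib]
  set A := Finset.univ.filter fun a => 0 < pT P₁ a with hA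
  have hzero : ∀ a ∉ A, pT P₁ a = 0 := fun a ha =>
    le_antisymm (by simpa [hA] using ha) (hpT0 a)
  have hpTA : ∀ b, pT P₂ b = ∑ a ∈ A, pT P₁ a * G a b := fun b => by
    rw [hpT, ← Finset.sum_subset (Finset.subset_univ A)]
    intro a _ ha
    rw [hzero a ha, zero_mul]
  have hYA : ∀ b, pYT P₂ true b = ∑ a ∈ A, pT P₁ a * G a b * postYT P₁ a := fun b => by
    rw [hG, ← Finset.sum_subset (Finset.subset_univ A)]
    · refine Finset.sum_congr rfl fun a ha => ?_
      have : pT P₁ a ≠ 0 := (by simpa [hA] using ha : 0 < pT P₁ a).ne'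
      rw [postYT]
      field_simp
    · intro a _ ha
      have h := hzero a ha
      rw [pT_eq_add] at h
      rw [show pYT P₁ true a = 0 by linarith [hY true a, hY false a], zero_mul]
  have hpost : ∀ a ∈ A, postYT P₁ a ∈ Set.Icc (0 : ℝ) 1 := fun a ha => by
    have : 0 < pT P₁ a := by simpa [hA] using ha
    refine ⟨div_nonneg (hY _ a) this.le, (div_le_one this).2 ?_⟩
    rw [pT_eq_add]
    linarith [hY false a]
  have key : ∀ b ∈ Finset.univ.filter (fun b => 0 < pT P₂ b),
      pT P₂ b * u (postYT P₂ b) ≤ ∑ a ∈ A, pT P₁ a * G a b * u (postYT P₁ a) := by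
    intro b hb
    have hb : 0 < pT P₂ b := by simpa using hb
    have hJ := hu.map_sum_le (t := A) (w := fun a => pT P₁ a * G a b / pT P₂ b)
      (p := fun a => postYT P₁ a)
      (fun a _ => div_nonneg (mul_nonneg (hpT0 a) (hG0 a b)) hb.le)
      (by rw [← Finset.sum_div, ← hpTA, div_self hb.ne']) hpost
    have e1 : ∑ a ∈ A, (pT P₁ a * G a b / pT P₂ b) • postYT P₁ a = postYT P₂ b := by
      rw [postYT, hYA, Finset.sum_div]
      refine Finset.sum_congr rfl fun a _ => ?_
      rw [smul_eq_mul]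
      ring
    rw [e1] at hJ
    calc pT P₂ b * u (postYT P₂ b) ≤ pT P₂ b * _ := mul_le_mul_of_nonneg_left hJ hb.le
      _ = _ := by
        rw [Finset.mul_sum]
        refine Finset.sum_congr rfl fun a _ => ?_
        rw [smul_eq_mul]
        field_simp
  calc EU P₂ u ≤ ∑ b ∈ Finset.univ.filter (fun b => 0 < pT P₂ b),
        ∑ a ∈ A, pT P₁ a * G a b * u (postYT P₁ a) := Finset.sum_le_sum key
    _ = ∑ b, ∑ a ∈ A, pT P₁ a * G a b * u (postYT P₁ a) := by
      refine Finset.sum_subset (Finset.subset_univ _) fun b _ hb => ?_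
      have hnn : ∀ a ∈ A, 0 ≤ pT P₁ a * G a b := fun a _ => mul_nonneg (hpT0 a) (hG0 a b)
      have hb0 : ∑ a ∈ A, pT P₁ a * G a b = 0 := by
        rw [← hpTA]
        refine le_antisymm (by simpa using hb) ?_
        rw [hpTA]
        exact Finset.sum_nonneg hnn
      refine Finset.sum_eq_zero fun a ha => ?_
      rw [(Finset.sum_eq_zero_iff_of_nonneg hnn).1 hb0 a ha, zero_mul]
    _ = EU P₁ u := by
      rw [Finset.sum_comm]
      refine Finset.sum_congr rfl fun a _ => ?_
      simp_rw [← Finset.sum_mul, ← Finset.mul_sum, hG1, mul_one]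

theorem exists_mem_fst_eq {K : Set (ℝ × ℝ)} (hK : Convex ℝ K) (h0 : ((0 : ℝ), (0 : ℝ)) ∈ K)
    {k X₁ Z₁ X₂ x₁ z₀ : ℝ} (hk : 0 ≤ k) (h1 : (X₁, Z₁) ∈ K) (h2 : (X₂, k * X₂) ∈ K)
    (hx₁ : 0 ≤ x₁) (hxX : x₁ < X₁) (hZ : k * X₂ ≤ Z₁)
    (hz₂ : z₀ ≤ k * X₂) (hzk : z₀ ≤ k * x₁) :
    ∃ z, (x₁, z) ∈ K ∧ z₀ ≤ z ∧ z ≤ Z₁ := by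
  rcases le_total x₁ X₂ with h | h
  · refine ⟨k * x₁, ?_, hzk, (mul_le_mul_of_nonneg_left h hk).trans hZ⟩
    rcases eq_or_lt_of_le (hx₁.trans h) with h' | h'
    · rwa [le_antisymm h (h' ▸ hx₁)]
    · have := hK h2 h0 (a := x₁ / X₂) (b := 1 - x₁ / X₂) (by positivity)
        (sub_nonneg.2 ((div_le_one h').2 h)) (by ring)
      convert this using 1
      ext <;> simp <;> field_simp
  · have hd : 0 < X₁ - X₂ := by linarith
    set θ := (x₁ - X₂) / (X₁ - X₂) with hθ
    have hθ0 : 0 ≤ θ := div_nonneg (by linarith) hd.le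
    have hθ1 : θ ≤ 1 := (div_le_one hd).2 (by linarith)
    have hθe : θ * (X₁ - X₂) = x₁ - X₂ := div_mul_cancel₀ _ hd.ne'
    refine ⟨θ * Z₁ + (1 - θ) * (k * X₂), ?_, by nlinarith, by nlinarith⟩
    have := hK h1 h2 hθ0 (sub_nonneg.2 hθ1) (by ring)
    convert this using 1
    ext
    · simp only [Prod.smul_mk, Prod.mk_add_mk, smul_eq_mul]
      linarith
    · simp

/-- A planar convex set containing the origin, two points on the boundary rays of the cone
`{X ≤ k Z, Z ≤ k X}` and a common upper bound of them meets the box `[x₀, x₁] × [z₀, z₁]`. -/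
theorem exists_mem_box {K : Set (ℝ × ℝ)} (hK : Convex ℝ K) (h0 : ((0 : ℝ), (0 : ℝ)) ∈ K)
    {k X₁ Z₁ X₂ Z₃ x₀ x₁ z₀ z₁ : ℝ} (hk : 0 ≤ k) (h1 : (X₁, Z₁) ∈ K) (h2 : (X₂, k * X₂) ∈ K)
    (h3 : (k * Z₃, Z₃) ∈ K) (hx : x₀ ≤ x₁) (hz : z₀ ≤ z₁) (hx₁ : 0 ≤ x₁) (hz₁ : 0 ≤ z₁)
    (hxX : x₀ ≤ X₁) (hzZ : z₀ ≤ Z₁)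
    (hX₂ : k * X₂ ≤ Z₁) (hz₂ : z₀ ≤ k * X₂) (hzk : z₀ ≤ k * x₁)
    (hZ₃ : k * Z₃ ≤ X₁) (hx₃ : x₀ ≤ k * Z₃) (hxk : x₀ ≤ k * z₁) :
    ∃ x z, (x, z) ∈ K ∧ x₀ ≤ x ∧ x ≤ x₁ ∧ z₀ ≤ z ∧ z ≤ z₁ := by
  have hswap : z₁ < Z₁ → ∃ x, (x, z₁) ∈ K ∧ x₀ ≤ x ∧ x ≤ X₁ := fun h =>
    exists_mem_fst_eq (K := Prod.swap ⁻¹' K)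
      (hK.linear_preimage (LinearEquiv.prodComm ℝ ℝ ℝ).toLinearMap) h0 hk h1 h3 hz₁ h hZ₃
      hx₃ hxk
  rcases le_or_gt X₁ x₁ with hX | hX
  · rcases le_or_gt Z₁ z₁ with hZ | hZ
    · exact ⟨X₁, Z₁, h1, hxX, hX, hzZ, hZ⟩
    · obtain ⟨x, hm, hl, hr⟩ := hswap hZ
      exact ⟨x, z₁, hm, hl, hr.trans hX, hz, le_rfl⟩
  obtain ⟨z, hm, hl, hr⟩ := exists_mem_fst_eq hK h0 hk h1 h2 hx₁ hX hX₂ hz₂ hzk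
  rcases le_or_gt z z₁ with hzz | hzz
  · exact ⟨x₁, z, hm, hx, le_rfl, hl, hzz⟩
  obtain ⟨x, hm', hl', -⟩ := hswap (hzz.trans_le hr)
  rcases le_or_gt x x₁ with hxx | hxx
  · exact ⟨x, z₁, hm', hl', hxx, hz, le_rfl⟩
  have hz0 : 0 < z := hz₁.trans_lt hzz
  set θ := z₁ / z with hθ
  have hθ0 : 0 ≤ θ := by positivity
  have hθ1 : θ ≤ 1 := (div_le_one hz0).2 hzz.le
  have hθz : θ * z = z₁ := div_mul_cancel₀ _ hz0.ne'
  have hy : (θ * x₁, z₁) ∈ K := by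
    have := hK hm h0 hθ0 (sub_nonneg.2 hθ1) (by ring)
    convert this using 1
    ext <;> simp [hθz]
  have hle : θ * x₁ ≤ x₁ := mul_le_of_le_one_left hx₁ hθ1
  have hd : 0 < x - θ * x₁ := by linarith
  set η := (x₁ - θ * x₁) / (x - θ * x₁) with hη
  have hηe : η * (x - θ * x₁) = x₁ - θ * x₁ := div_mul_cancel₀ _ hd.ne'
  refine ⟨x₁, z₁, ?_, hx, le_rfl, hz, le_rfl⟩
  have := hK hm' hy (a := η) (b := 1 - η) (div_nonneg (by linarith) hd.le)
    (sub_nonneg.2 ((div_le_one hd).2 (by linarith))) (by ring)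
  convert this using 1
  ext
  · simp only [Prod.smul_mk, Prod.mk_add_mk, smul_eq_mul]
    linarith
  · simp only [Prod.smul_mk, Prod.mk_add_mk, smul_eq_mul]
    ring

/-- The totals of the pairs `(X t, Z t)` in the cone `{X ≤ k Z, Z ≤ k X}` bounded above by
`(a t, d t)`. -/
def splitTotals {T : Type} [Fintype T] (k : ℝ) (a d : T → ℝ) : Set (ℝ × ℝ) :=
  {p | ∃ X Z : T → ℝ, (∀ t, X t ≤ a t ∧ Z t ≤ d t ∧ X t ≤ k * Z t ∧ Z t ≤ k * X t) ∧
    ∑ t, X t = p.1 ∧ ∑ t, Z t = p.2}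

theorem convex_splitTotals {T : Type} [Fintype T] (k : ℝ) (a d : T → ℝ) :
    Convex ℝ (splitTotals k a d) := by
  rintro p ⟨X, Z, h, hX, hZ⟩ p' ⟨X', Z', h', hX', hZ'⟩ α β hα hβ hαβ
  refine ⟨fun t => α * X t + β * X' t, fun t => α * Z t + β * Z' t, fun t => ?_, ?_, ?_⟩
  · obtain ⟨h1, h2, h3, h4⟩ := h t
    obtain ⟨h1', h2', h3', h4'⟩ := h' t
    have hβ' : β = 1 - α := by linarith
    subst hβ'
    refine ⟨?_, ?_, ?_, ?_⟩
    · linarith [mul_le_mul_of_nonneg_left h1 hα, mul_le_mul_of_nonneg_left h1' hβ]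
    · linarith [mul_le_mul_of_nonneg_left h2 hα, mul_le_mul_of_nonneg_left h2' hβ]
    · linarith [mul_le_mul_of_nonneg_left h3 hα, mul_le_mul_of_nonneg_left h3' hβ]
    · linarith [mul_le_mul_of_nonneg_left h4 hα, mul_le_mul_of_nonneg_left h4' hβ]
  · simp [Finset.sum_add_distrib, ← Finset.mul_sum, hX, hX']
  · simp [Finset.sum_add_distrib, ← Finset.mul_sum, hZ, hZ']

theorem exists_split {T : Type} [Fintype T] {k : ℝ} (hk : 1 < k) {a b c d : T → ℝ}
    (ha : ∀ t, 0 ≤ a t) (hb : ∀ t, 0 ≤ b t) (hc : ∀ t, 0 ≤ c t) (hd : ∀ t, 0 ≤ d t)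
    (h₁ : ∀ t, a t + b t ≤ k * (c t + d t)) (h₂ : ∀ t, c t + d t ≤ k * (a t + b t))
    (hab : ∑ t, a t + ∑ t, b t = 1) (hcd : ∑ t, c t + ∑ t, d t = 1)
    (hca : ∑ t, c t ≤ ∑ t, a t) :
    ∃ x z, (x, z) ∈ splitTotals k a d ∧ ∑ t, a t - k * ∑ t, c t ≤ x ∧
      x ≤ ∑ t, a t - (∑ t, c t) / k ∧ ∑ t, d t - k * ∑ t, b t ≤ z ∧
      z ≤ ∑ t, d t - (∑ t, b t) / k := by
  have hk0 : 0 < k := by linarith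
  have hkk : k⁻¹ ≤ 1 := inv_le_one_of_one_le₀ hk.le
  have hb0 : 0 ≤ ∑ t, b t := Finset.sum_nonneg fun t _ => hb t
  have hc0 : 0 ≤ ∑ t, c t := Finset.sum_nonneg fun t _ => hc t
  have hbk : (∑ t, b t) / k ≤ ∑ t, b t := div_le_self hb0 hk.le
  have hck : (∑ t, c t) / k ≤ ∑ t, c t := div_le_self hc0 hk.le
  have hck' : k * ((∑ t, c t) / k) = ∑ t, c t := by field_simp
  have hbk' : k * ((∑ t, b t) / k) = ∑ t, b t := by field_simp
  set α : T → ℝ := fun t => max 0 (a t - k * c t) with hα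
  set δ : T → ℝ := fun t => max 0 (d t - k * b t) with hδ
  have hα0 : ∀ t, 0 ≤ α t := fun t => le_max_left _ _
  have hδ0 : ∀ t, 0 ≤ δ t := fun t => le_max_left _ _
  have hαl : ∀ t, a t - k * c t ≤ α t := fun t => le_max_right _ _
  have hδl : ∀ t, d t - k * b t ≤ δ t := fun t => le_max_right _ _
  have hαa : ∀ t, α t ≤ a t := fun t => max_le (ha t) (by nlinarith [hc t])
  have hδd : ∀ t, δ t ≤ d t := fun t => max_le (hd t) (by nlinarith [hb t])
  have hαd : ∀ t, k⁻¹ * α t ≤ d t := fun t => by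
    rw [inv_mul_le_iff₀ hk0]
    exact max_le (mul_nonneg hk0.le (hd t)) (by nlinarith [h₁ t, hb t])
  have hδa : ∀ t, k⁻¹ * δ t ≤ a t := fun t => by
    rw [inv_mul_le_iff₀ hk0]
    exact max_le (mul_nonneg hk0.le (ha t)) (by nlinarith [h₂ t, hc t])
  have hshrink : ∀ r : ℝ, 0 ≤ r → k⁻¹ * r ≤ r := fun r hr => mul_le_of_le_one_left hr hkk
  have hgrow : ∀ r : ℝ, 0 ≤ r → r ≤ k * r := fun r hr => le_mul_of_one_le_left hr hk.le
  have hcancel : ∀ r : ℝ, k * (k⁻¹ * r) = r := fun r => mul_inv_cancel_left₀ hk0.ne' r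
  have m0 : ((0 : ℝ), (0 : ℝ)) ∈ splitTotals k a d :=
    ⟨fun _ => 0, fun _ => 0, fun t => by simp [ha t, hd t], by simp, by simp⟩
  have m1 : (∑ t, max (α t) (k⁻¹ * δ t), ∑ t, max (δ t) (k⁻¹ * α t)) ∈ splitTotals k a d := by
    refine ⟨_, _, fun t => ⟨max_le (hαa t) (hδa t), max_le (hδd t) (hαd t), max_le ?_ ?_,
      max_le ?_ ?_⟩, rfl, rfl⟩
    · calc α t = k * (k⁻¹ * α t) := (hcancel _).symm
        _ ≤ _ := mul_le_mul_of_nonneg_left (le_max_right _ _) hk0.le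
    · calc k⁻¹ * δ t ≤ δ t := hshrink _ (hδ0 t)
        _ ≤ k * δ t := hgrow _ (hδ0 t)
        _ ≤ _ := mul_le_mul_of_nonneg_left (le_max_left _ _) hk0.le
    · calc δ t = k * (k⁻¹ * δ t) := (hcancel _).symm
        _ ≤ _ := mul_le_mul_of_nonneg_left (le_max_right _ _) hk0.le
    · calc k⁻¹ * α t ≤ α t := hshrink _ (hα0 t)
        _ ≤ k * α t := hgrow _ (hα0 t)
        _ ≤ _ := mul_le_mul_of_nonneg_left (le_max_left _ _) hk0.le
  have m2 : (∑ t, k⁻¹ * δ t, k * ∑ t, k⁻¹ * δ t) ∈ splitTotals k a d := by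
    refine ⟨_, δ, fun t => ⟨hδa t, hδd t, (hshrink _ (hδ0 t)).trans (hgrow _ (hδ0 t)),
      (hcancel _).ge⟩, rfl, ?_⟩
    simp [← Finset.mul_sum, hcancel]
  have m3 : (k * ∑ t, k⁻¹ * α t, ∑ t, k⁻¹ * α t) ∈ splitTotals k a d := by
    refine ⟨α, _, fun t => ⟨hαa t, hαd t, (hcancel _).ge,
      (hshrink _ (hα0 t)).trans (hgrow _ (hα0 t))⟩, ?_, rfl⟩
    simp [← Finset.mul_sum, hcancel]
  have lowX : ∑ t, a t - k * ∑ t, c t ≤ ∑ t, α t := by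
    rw [Finset.mul_sum, ← Finset.sum_sub_distrib]
    exact Finset.sum_le_sum fun t _ => hαl t
  have lowZ : ∑ t, d t - k * ∑ t, b t ≤ ∑ t, δ t := by
    rw [Finset.mul_sum, ← Finset.sum_sub_distrib]
    exact Finset.sum_le_sum fun t _ => hδl t
  have e2 : k * ∑ t, k⁻¹ * δ t = ∑ t, δ t := by rw [← Finset.mul_sum, hcancel]
  have e3 : k * ∑ t, k⁻¹ * α t = ∑ t, α t := by rw [← Finset.mul_sum, hcancel]
  have l1 : ∑ t, α t ≤ ∑ t, max (α t) (k⁻¹ * δ t) :=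
    Finset.sum_le_sum fun t _ => le_max_left _ _
  have l2 : ∑ t, δ t ≤ ∑ t, max (δ t) (k⁻¹ * α t) :=
    Finset.sum_le_sum fun t _ => le_max_left _ _
  refine exists_mem_box (convex_splitTotals k a d) m0 hk0.le m1 m2 m3 ?_ ?_ ?_ ?_
    (lowX.trans l1) (lowZ.trans l2) (e2.trans_le l2) (lowZ.trans e2.ge) ?_
    (e3.trans_le l1) (lowX.trans e3.ge) ?_
  · linarith [hgrow _ hc0]
  · linarith [hgrow _ hb0]
  · linarith
  · linarith
  · nlinarith
  · nlinarith

/-- The four-signal structure: signals `0` and `3` reveal `Y`, while on the signals `1` and `2`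
the secret determines `Y`. -/
def fourSignal (p₀ p₁ k q₀ q₁ m n x y : ℝ) : Fin 2 → Bool → Fin 4 → ℝ := fun s v =>
  ![bif v then ![p₀ * x, p₀ * (k * m), p₀ * n, 0] else ![0, 0, 0, p₀ * (1 - q₀)],
    bif v then ![p₁ * q₁, 0, 0, 0] else ![0, p₁ * m, p₁ * (k * n), p₁ * y]] s

/-- with a binary secret, any ε-IP Blackwell optimal structure has
an equivalent optimal structure on four signals whose conditional widths
`l_i^{(j)} = P(T=t_i|S=s_j)` satisfy the feasibility conditions. -/
theorem statement4 {Th : Type} [Fintype Th]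
    (ε : ℝ) (hε : 0 < ε)
    (Phat : Fin 2 → Bool → Th → ℝ)
    (hopt : BlackwellOptimal ε Phat)
    (hq : qS Phat 1 ≤ qS Phat 0) :
    ∃ P : Fin 2 → Bool → Fin 4 → ℝ,
      BlackwellOptimal ε P ∧
      (∀ s y, pSY P s y = pSY Phat s y) ∧
      (∀ u : ℝ → ℝ, ConvexOn ℝ (Set.Icc 0 1) u → EU P u = EU Phat u) ∧
      condTS P 0 1 = qS Phat 1 ∧
      condTS P 3 0 = 1 - qS Phat 0 ∧
      condTS P 1 0 = Real.exp ε * condTS P 1 1 ∧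
      condTS P 2 1 = Real.exp ε * condTS P 2 0 ∧
      Real.exp (-ε) * condTS P 0 1 ≤ condTS P 0 0 ∧
      condTS P 0 0 ≤ Real.exp ε * condTS P 0 1 ∧
      Real.exp (-ε) * condTS P 3 0 ≤ condTS P 3 1 ∧
      condTS P 3 1 ≤ Real.exp ε * condTS P 3 0 ∧
      (∀ j : Fin 2, ∑ i : Fin 4, condTS P i j = 1) ∧
      (∀ (i : Fin 4) (j : Fin 2), 0 ≤ condTS P i j) := by
  have hinfo := hopt.1
  have hip := hopt.2.1
  obtain ⟨hnn, hsum, hpos⟩ := hinfo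
  set k := Real.exp ε with hkdef
  have hk : 1 < k := Real.one_lt_exp_iff.2 hε
  have hk0 : 0 < k := by linarith
  have hexp : Real.exp (-ε) = k⁻¹ := Real.exp_neg ε
  set p₀ := pS Phat 0 with hp₀
  set p₁ := pS Phat 1 with hp₁
  have p₀pos : 0 < p₀ := hpos 0
  have p₁pos : 0 < p₁ := hpos 1
  set q₀ := qS Phat 0 with hq₀
  set q₁ := qS Phat 1 with hq₁
  have hp01 : p₀ + p₁ = 1 := by rw [← hsum, Fin.sum_univ_two]; rfl
  have hne : Nonempty Th := by
    by_contra h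
    rw [not_nonempty_iff] at h
    simp at hsum
  have hsumdiv : ∀ s y, ∑ t, Phat s y t / pS Phat s = pSY Phat s y / pS Phat s := fun s y => by
    rw [← Finset.sum_div]; rfl
  have hSYsum : ∀ s, pSY Phat s true + pSY Phat s false = pS Phat s := fun s => by
    simp [pS, pSY]
  have hSYt : ∀ s, pSY Phat s true = pS Phat s * qS Phat s := fun s => by
    rw [qS, mul_div_cancel₀ _ (hpos s).ne']
  have hfalse : ∀ s, pSY Phat s false / pS Phat s = 1 - qS Phat s := fun s => by
    rw [qS, eq_sub_iff_add_eq, ← add_div, add_comm, hSYsum, div_self (hpos s).ne']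
  have hcond : ∀ s t, condTS Phat t s = Phat s true t / pS Phat s + Phat s false t / pS Phat s :=
    fun s t => by simp [condTS, pST, add_div]
  have hdivnn : ∀ s y t, 0 ≤ Phat s y t / pS Phat s := fun s y t =>
    div_nonneg (hnn s y t) (hpos s).le
  have hq₁0 : 0 ≤ q₁ := div_nonneg (Finset.sum_nonneg fun t _ => hnn 1 true t) p₁pos.le
  have hq₀1 : 0 ≤ 1 - q₀ := by
    rw [hq₀, ← hfalse]
    exact div_nonneg (Finset.sum_nonneg fun t _ => hnn 0 false t) p₀pos.le
  have ea : ∑ t, Phat 0 true t / p₀ = q₀ := hsumdiv 0 true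
  have eb : ∑ t, Phat 0 false t / p₀ = 1 - q₀ := (hsumdiv 0 false).trans (hfalse 0)
  have ec : ∑ t, Phat 1 true t / p₁ = q₁ := hsumdiv 1 true
  have ed : ∑ t, Phat 1 false t / p₁ = 1 - q₁ := (hsumdiv 1 false).trans (hfalse 1)
  obtain ⟨X, Z, ⟨x, z, hxz, hX, hZ⟩, hX0, hX1, hZ0, hZ1⟩ :=
    exists_split hk (hdivnn 0 true) (hdivnn 0 false) (hdivnn 1 true) (hdivnn 1 false)
      (fun t => by simpa only [hcond] using hip 0 1 t)
      (fun t => by simpa only [hcond] using hip 1 0 t)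
      (by rw [ea, eb]; ring) (by rw [ec, ed]; ring) (by rw [ea, ec]; exact hq)
  rw [ea, ec] at hX0 hX1
  rw [ed, eb] at hZ0 hZ1
  simp only at hX hZ
  have hkk : 0 < k ^ 2 - 1 := by nlinarith
  set μ : Th → ℝ := fun t => (k * x t - z t) / (k ^ 2 - 1) with hμ
  set ν : Th → ℝ := fun t => (k * z t - x t) / (k ^ 2 - 1) with hν
  have hμ0 : ∀ t, 0 ≤ μ t := fun t => div_nonneg (by linarith [(hxz t).2.2.2]) hkk.le
  have hν0 : ∀ t, 0 ≤ ν t := fun t => div_nonneg (by linarith [(hxz t).2.2.1]) hkk.le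
  have hxμ : ∀ t, k * μ t + ν t = x t := fun t => by simp only [hμ, hν]; field_simp; ring
  have hzμ : ∀ t, μ t + k * ν t = z t := fun t => by simp only [hμ, hν]; field_simp; ring
  set m := ∑ t, μ t with hm
  set n := ∑ t, ν t with hn
  have hm0 : 0 ≤ m := Finset.sum_nonneg fun t _ => hμ0 t
  have hn0 : 0 ≤ n := Finset.sum_nonneg fun t _ => hν0 t
  have hXm : k * m + n = X := by
    rw [hm, hn, Finset.mul_sum, ← Finset.sum_add_distrib, ← hX]
    exact Finset.sum_congr rfl fun t _ => hxμ t
  have hZm : m + k * n = Z := by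
    rw [hm, hn, Finset.mul_sum, ← Finset.sum_add_distrib, ← hZ]
    exact Finset.sum_congr rfl fun t _ => hzμ t
  have hxl : q₁ / k ≤ q₀ - X := by linarith
  have hyl : (1 - q₀) / k ≤ 1 - q₁ - Z := by linarith
  have hx0 : 0 ≤ q₀ - X := (div_nonneg hq₁0 hk0.le).trans hxl
  have hy0 : 0 ≤ 1 - q₁ - Z := (div_nonneg hq₀1 hk0.le).trans hyl
  have hxk : q₁ ≤ k * (q₀ - X) := (div_le_iff₀' hk0).1 hxl
  have hyk : 1 - q₀ ≤ k * (1 - q₁ - Z) := (div_le_iff₀' hk0).1 hyl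
  set P := fourSignal p₀ p₁ k q₀ q₁ m n (q₀ - X) (1 - q₁ - Z) with hP
  have hPnn : ∀ s y t, 0 ≤ P s y t := by
    intro s y t
    fin_cases s <;> cases y <;> fin_cases t <;> simp [hP, fourSignal] <;> positivity
  have hPSY : ∀ s y, pSY P s y = pSY Phat s y := by
    have ht := hSYt
    have hf : ∀ s, pSY Phat s false = pS Phat s * (1 - qS Phat s) := fun s => by
      rw [← hfalse, mul_div_cancel₀ _ (hpos s).ne']
    intro s y
    fin_cases s <;> cases y
    · refine Eq.trans ?_ (hf 0).symm
      simp [pSY, hP, fourSignal, Fin.sum_univ_four, hp₀, hq₀]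
    · refine Eq.trans ?_ (ht 0).symm
      simp [pSY, hP, fourSignal, Fin.sum_univ_four]
      rw [← hXm]; ring
    · refine Eq.trans ?_ (hf 1).symm
      simp [pSY, hP, fourSignal, Fin.sum_univ_four]
      rw [← hZm]; ring
    · refine Eq.trans ?_ (ht 1).symm
      simp [pSY, hP, fourSignal, Fin.sum_univ_four, hp₁, hq₁]
  have hPS : ∀ s, pS P s = pS Phat s := fun s => by
    rw [← hSYsum, ← hPSY, ← hPSY]; simp [pS, pSY]
  have hPS0 : pS P 0 = p₀ := hPS 0
  have hPS1 : pS P 1 = p₁ := hPS 1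
  have c00 : condTS P 0 0 = q₀ - X := by
    rw [condTS, hPS0]; simp [pST, hP, fourSignal]; field_simp
  have c01 : condTS P 0 1 = q₁ := by
    rw [condTS, hPS1]; simp [pST, hP, fourSignal]; field_simp
  have c10 : condTS P 1 0 = k * m := by
    rw [condTS, hPS0]; simp [pST, hP, fourSignal]; field_simp
  have c11 : condTS P 1 1 = m := by
    rw [condTS, hPS1]; simp [pST, hP, fourSignal]; field_simp
  have c20 : condTS P 2 0 = n := by
    rw [condTS, hPS0]; simp [pST, hP, fourSignal]; field_simp
  have c21 : condTS P 2 1 = k * n := by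
    rw [condTS, hPS1]; simp [pST, hP, fourSignal]; field_simp
  have c30 : condTS P 3 0 = 1 - q₀ := by
    rw [condTS, hPS0]; simp [pST, hP, fourSignal]; field_simp
  have c31 : condTS P 3 1 = 1 - q₁ - Z := by
    rw [condTS, hPS1]; simp [pST, hP, fourSignal]; field_simp
  have hgrow : ∀ r : ℝ, 0 ≤ r → r ≤ k * r := fun r hr => le_mul_of_one_le_left hr hk.le
  have hxu : q₀ - X ≤ k * q₁ := by linarith
  have hyu : 1 - q₁ - Z ≤ k * (1 - q₀) := by linarith
  have hPinfo : InfoStructure P := by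
    refine ⟨hPnn, ?_, fun s => (hPS s).symm ▸ hpos s⟩
    rw [← hp01, Fin.sum_univ_two]
    exact congrArg₂ (· + ·) hPS0 hPS1
  have hkm := hgrow m hm0
  have hkn := hgrow n hn0
  have hPip : IsIP ε P := by
    have hkkm := hgrow (k * m) (by positivity)
    have hkkn := hgrow (k * n) (by positivity)
    intro s₁ s₂ t
    rw [← hkdef]
    fin_cases s₁ <;> fin_cases s₂ <;> fin_cases t <;>
      simp only [Fin.zero_eta, Fin.mk_one, Fin.reduceFinMk, c00, c01, c10, c11, c20, c21, c30,
        c31] <;>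
      first | apply hgrow; positivity | linarith
  have hdom : BlackwellDom (pYT P) (pYT Phat) := by
    have hsplit : ∀ t, 0 ≤ pYT Phat true t - p₀ * x t ∧ 0 ≤ pYT Phat false t - p₁ * z t := by
      intro t
      obtain ⟨h1, h2, -, -⟩ := hxz t
      rw [le_div_iff₀' p₀pos] at h1
      rw [le_div_iff₀' p₁pos] at h2
      simp only [pYT, Fin.sum_univ_two]
      constructor <;> linarith [hnn 1 true t, hnn 0 false t]
    have hYsum : ∀ y, ∑ t, pYT Phat y t = pSY Phat 0 y + pSY Phat 1 y := fun y => by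
      simp [pYT, pSY, Finset.sum_add_distrib]
    have hYt : ∑ t, (pYT Phat true t - p₀ * x t) = p₀ * (q₀ - X) + p₁ * q₁ := by
      rw [Finset.sum_sub_distrib, ← Finset.mul_sum, hX, hYsum, hSYt, hSYt]
      ring
    have hYf : ∑ t, (pYT Phat false t - p₁ * z t) = p₀ * (1 - q₀) + p₁ * (1 - q₁ - Z) := by
      have h0 := hSYsum 0
      have h1 := hSYsum 1
      rw [hSYt] at h0 h1
      rw [Finset.sum_sub_distrib, ← Finset.mul_sum, hZ, hYsum]
      linear_combination h0 + h1
    refine blackwellDom_of_split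
      (fun i v => ![bif v then 1 else 0, bif v then p₀ * k else p₁, bif v then p₀ else p₁ * k,
        bif v then 0 else 1] i)
      (fun i t => ![pYT Phat true t - p₀ * x t, μ t, ν t, pYT Phat false t - p₁ * z t] i)
      (fun i t => ?_) (fun v i => ?_) (fun v t => ?_)
    · fin_cases i
      exacts [(hsplit t).1, hμ0 t, hν0 t, (hsplit t).2]
    · have hg : ∑ t, ![pYT Phat true t - p₀ * x t, μ t, ν t, pYT Phat false t - p₁ * z t] i =
          ![p₀ * (q₀ - X) + p₁ * q₁, m, n, p₀ * (1 - q₀) + p₁ * (1 - q₁ - Z)] i := by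
        fin_cases i
        exacts [hYt, rfl, rfl, hYf]
      rw [hg]
      fin_cases i <;> cases v <;> simp [pYT, hP, fourSignal] <;> ring
    · cases v
      · simp [Fin.sum_univ_four]
        linear_combination -p₁ * hzμ t
      · simp [Fin.sum_univ_four]
        linear_combination -p₀ * hxμ t
  have hdom' : BlackwellDom (pYT Phat) (pYT P) := by
    by_contra h
    exact hopt.2.2 ⟨4, P, hPinfo, hPip, hPSY, hdom, h⟩
  refine ⟨P, ⟨hPinfo, hPip, ?_⟩, hPSY, fun u hu => le_antisymm (EU_le_of_blackwellDom hnn hdom' hu)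
    (EU_le_of_blackwellDom hPnn hdom hu), c01, c30, by rw [c10, c11], by rw [c20, c21],
    ?_, ?_, ?_, ?_, ?_, ?_⟩
  · rintro ⟨N, P', hI, hIP, hSY, hd, hnd⟩
    exact hopt.2.2 ⟨N, P', hI, hIP, fun s y => (hSY s y).trans (hPSY s y), hd.trans hdom,
      fun h => hnd (hdom.trans h)⟩
  · rw [hexp, c00, c01, inv_mul_le_iff₀ hk0]; exact hxk
  · rw [c00, c01]; exact hxu
  · rw [hexp, c30, c31, inv_mul_le_iff₀ hk0]; exact hyk
  · rw [c30, c31]; exact hyu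
  · intro j
    fin_cases j <;>
      simp only [Fin.sum_univ_four, Fin.zero_eta, Fin.mk_one, c00, c01, c10, c11, c20, c21, c30,
        c31] <;> linarith
  · intro i j
    exact div_nonneg (Finset.sum_nonneg fun y _ => hPnn j y i) (hPS j ▸ (hpos j).le)

end IPPaper
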